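/- Let G be a graph on vertex set {1,…,n} with e-expansion X_G(x) = Σ_λ c_λ e_λ. If c_λ ≠ 0, then for all k ≥ 1 we have α_k(G) ≥ λ'_1 + ⋯ + λ'_k and ω_k(G) ≤ λ_1 + ⋯ + λ_k. Moreover, if G is a graph whose chromatic quasisymmetric function X_G(x;q) = Σ_λ c_λ(q) e_λ is symmetric and c_λ(q) ≠ 0, then both inequalities again hold for all k ≥ 1. -/

import Mathlib

open Finset MvPolynomial
open scoped Classical

noncomputable section

/-- `κ` is a proper colouring of `G`. -/
def IsProper {n N : ℕ} (G : SimpleGraph (Fin n)) (κ : Fin n → Fin N) : Prop :=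
  ∀ i j, G.Adj i j → κ i ≠ κ j

/-- The chromatic symmetric function of `G`, truncated to `N` variables. -/
def chromSym (n N : ℕ) (G : SimpleGraph (Fin n)) : MvPolynomial (Fin N) ℤ :=
  ∑ κ : Fin n → Fin N, if IsProper G κ then ∏ i, X (κ i) else 0

/-- The number of ascents of a colouring. -/
def ascNum {n N : ℕ} (G : SimpleGraph (Fin n)) (κ : Fin n → Fin N) : ℕ :=
  ((Finset.univ : Finset (Fin n × Fin n)).filter fun p =>
    G.Adj p.1 p.2 ∧ p.1 < p.2 ∧ κ p.1 < κ p.2).card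

/-- The chromatic quasisymmetric function of `G`, with coefficients in `ℤ[q]`,
truncated to `N` variables. -/
def chromQSym (n N : ℕ) (G : SimpleGraph (Fin n)) :
    MvPolynomial (Fin N) (Polynomial ℤ) :=
  ∑ κ : Fin n → Fin N, if IsProper G κ then
    C (Polynomial.X ^ ascNum G κ) * ∏ i, X (κ i) else 0

/-- `e_λ`, the product of elementary symmetric polynomials over the parts of `λ`. -/
def eProd (N : ℕ) (R : Type) [CommSemiring R] {n : ℕ} (p : Nat.Partition n) :
    MvPolynomial (Fin N) R :=
  (p.parts.map fun k => esymm (Fin N) R k).prod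

/-- The number of parts of a partition, i.e. `λ'_1`. -/
def numParts {n : ℕ} (p : Nat.Partition n) : ℕ := Multiset.card p.parts

/-- The largest part `λ_1` of a partition. -/
def maxPart {n : ℕ} (p : Nat.Partition n) : ℕ := p.parts.sup

/-- `λ'_1 + ⋯ + λ'_k`, the number of cells in the first `k` columns of `λ`. -/
def conjSum {n : ℕ} (p : Nat.Partition n) (k : ℕ) : ℕ :=
  (p.parts.map fun a => min a k).sum

/-- `λ_1 + ⋯ + λ_k`, the number of cells in the first `k` rows of `λ`. -/
def partSum {n : ℕ} (p : Nat.Partition n) (k : ℕ) : ℕ :=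
  ∑ j ∈ Finset.Icc 1 n, min (Multiset.card (p.parts.filter fun a => j ≤ a)) k

/-- `s` is an independent set of vertices of `G`. -/
def IsIndepFinset {V : Type} (G : SimpleGraph V) (s : Finset V) : Prop :=
  ∀ i ∈ s, ∀ j ∈ s, ¬ G.Adj i j

/-- `s` is a clique of `G`. -/
def IsCliqueFinset {V : Type} (G : SimpleGraph V) (s : Finset V) : Prop :=
  ∀ i ∈ s, ∀ j ∈ s, i ≠ j → G.Adj i j

/-- The independence number `α(G)`. -/
def indepNum {n : ℕ} (G : SimpleGraph (Fin n)) : ℕ :=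
  sSup {k | ∃ s : Finset (Fin n), IsIndepFinset G s ∧ s.card = k}

/-- The clique number `ω(G)`. -/
def cliqueNum {n : ℕ} (G : SimpleGraph (Fin n)) : ℕ :=
  sSup {k | ∃ s : Finset (Fin n), IsCliqueFinset G s ∧ s.card = k}

/-- `α_k(G)`: the maximum number of vertices in an independent partition
with `k` blocks. -/
def alphaK {n : ℕ} (G : SimpleGraph (Fin n)) (k : ℕ) : ℕ :=
  sSup {m | ∃ B : Fin k → Finset (Fin n),
    (∀ i j, i ≠ j → Disjoint (B i) (B j)) ∧
    (∀ i, IsIndepFinset G (B i)) ∧ m = ∑ i, (B i).card}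

/-- `ω_k(G)`: the maximum number of vertices in a clique partition
with `k` blocks. -/
def omegaK {n : ℕ} (G : SimpleGraph (Fin n)) (k : ℕ) : ℕ :=
  sSup {m | ∃ B : Fin k → Finset (Fin n),
    (∀ i j, i ≠ j → Disjoint (B i) (B j)) ∧
    (∀ i, IsCliqueFinset G (B i)) ∧ m = ∑ i, (B i).card}

/-- `G` is a natural unit interval graph. -/
def IsNUIG {n : ℕ} (G : SimpleGraph (Fin n)) : Prop :=
  ∀ i j k : Fin n, i < j → j < k → G.Adj i k → G.Adj i j ∧ G.Adj j k

/-- The `q`-integer `[k]_q = 1 + q + ⋯ + q^(k-1)` in `ℤ[q]`. -/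
def qInt (k : ℕ) : Polynomial ℤ := ∑ i ∈ Finset.range k, Polynomial.X ^ i

/-- The `q`-factorial `[k]_q!` in `ℤ[q]`. -/
def qFact : ℕ → Polynomial ℤ
  | 0 => 1
  | k + 1 => qInt (k + 1) * qFact k

end

theorem aux_esymm_nat {N : ℕ} (m : Fin N →₀ ℕ) (a : ℕ) (s : Finset (Fin N))
    (h : coeff m (esymm (Fin N) ℕ a) ≠ 0) : ∑ i ∈ s, m i ≤ min a s.card := by
  have hm : m ∈ (esymm (Fin N) ℕ a).support := mem_support_iff.2 h
  rw [support_esymm] at hm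
  obtain ⟨t, ht, rfl⟩ := Finset.mem_image.1 hm
  rw [Finset.mem_powersetCard] at ht
  have : ∑ i ∈ s, (∑ j ∈ t, Finsupp.single j 1 : Fin N →₀ ℕ) i = (s ∩ t).card := by
    simp [Finsupp.finsetSum_apply, Finsupp.single_apply, Finset.sum_ite_eq']
  rw [this]
  exact le_min (ht.2 ▸ Finset.card_le_card Finset.inter_subset_right)
    (Finset.card_le_card Finset.inter_subset_left)

theorem aux_prod_le {N : ℕ} (s : Finset (Fin N)) (P : Multiset ℕ) :
    ∀ m : Fin N →₀ ℕ, coeff m ((P.map fun k => esymm (Fin N) ℕ k).prod) ≠ 0 →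
      ∑ i ∈ s, m i ≤ (P.map fun a => min a s.card).sum := by
  induction P using Multiset.induction_on with
  | empty =>
    intro m h
    simp only [Multiset.map_zero, Multiset.prod_zero, coeff_one] at h
    have : m = 0 := by
      by_contra h'
      exact h (if_neg fun h'' => h' h''.symm)
    simp [this]
  | cons a P ih =>
    intro m h
    rw [Multiset.map_cons, Multiset.prod_cons, coeff_mul] at h
    obtain ⟨x, hx, hne⟩ := Finset.exists_ne_zero_of_sum_ne_zero h
    rw [Finset.HasAntidiagonal.mem_antidiagonal] at hx
    have h1 := aux_esymm_nat x.1 a s (left_ne_zero_of_mul hne)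
    have h2 := ih x.2 (right_ne_zero_of_mul hne)
    rw [← hx, Multiset.map_cons, Multiset.sum_cons]
    simp only [Finsupp.add_apply, Finset.sum_add_distrib]
    omega

/-- The exponent vector of the conjugate of `P`. -/
noncomputable def conjMon (N : ℕ) (P : Multiset ℕ) : Fin N →₀ ℕ :=
  Finsupp.equivFunOnFinite.symm fun i => (P.filter fun a => i.val < a).card

theorem conjMon_cons (N a : ℕ) (P : Multiset ℕ) :
    conjMon N (a ::ₘ P) =
      (∑ j ∈ (Finset.univ : Finset (Fin N)).filter (fun i => i.val < a),
        Finsupp.single j 1) + conjMon N P := by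
  ext i
  simp only [conjMon, Finsupp.equivFunOnFinite_symm_apply_apply, Finsupp.add_apply,
    Finsupp.finsetSum_apply, Finsupp.single_apply]
  by_cases h : i.val < a <;> simp [h, add_comm]

theorem card_lt_fin {N a : ℕ} (h : a ≤ N) :
    ((Finset.univ : Finset (Fin N)).filter (fun i => i.val < a)).card = a := by
  simp [Fin.card_filter_val_lt, h]

theorem aux_prod_pos {N : ℕ} (P : Multiset ℕ) (h : ∀ a ∈ P, a ≤ N) :
    coeff (conjMon N P) ((P.map fun k => esymm (Fin N) ℕ k).prod) ≠ 0 := by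
  induction P using Multiset.induction_on with
  | empty =>
    have : conjMon N 0 = 0 := by ext i; simp [conjMon]
    simp [this]
  | cons a P ih =>
    rw [Multiset.map_cons, Multiset.prod_cons, coeff_mul, conjMon_cons]
    intro h0
    rw [Finset.sum_eq_zero_iff] at h0
    have h1 := h0 (_, _) (Finset.HasAntidiagonal.mem_antidiagonal.2 rfl)
    rcases mul_eq_zero.1 h1 with h2 | h2
    · have h3 : (∑ j ∈ (Finset.univ : Finset (Fin N)).filter (fun i => i.val < a),
        Finsupp.single j 1) ∈ (esymm (Fin N) ℕ a).support := by
        rw [support_esymm]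
        refine Finset.mem_image.2 ⟨_, ?_, rfl⟩
        rw [Finset.mem_powersetCard]
        exact ⟨Finset.subset_univ _, card_lt_fin (h a (Multiset.mem_cons_self a P))⟩
      exact (mem_support_iff.1 h3) h2
    · exact ih (fun b hb => h b (Multiset.mem_cons_of_mem hb)) h2

theorem eProd_coeff {N n : ℕ} (R : Type) [CommRing R] (p : Nat.Partition n) (m : Fin N →₀ ℕ) :
    coeff m (eProd N R p) = ((coeff m ((p.parts.map fun k => esymm (Fin N) ℕ k).prod) : ℕ) : R) := by
  have : eProd N R p = map (Nat.castRingHom R) ((p.parts.map fun k => esymm (Fin N) ℕ k).prod) := by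
    rw [eProd, map_multiset_prod, Multiset.map_map]
    congr 1
    refine Multiset.map_congr rfl fun a _ => ?_
    simp [map_esymm]
  rw [this, coeff_map]
  rfl

theorem conjMon_sum {N : ℕ} (P : Multiset ℕ) (h : ∀ a ∈ P, a ≤ N) (k : ℕ) :
    ∑ i ∈ (Finset.univ : Finset (Fin N)).filter (fun i => i.val < k), conjMon N P i
      = (P.map fun a => min a k).sum := by
  induction P using Multiset.induction_on with
  | empty => simp [conjMon]
  | cons a P ih =>
    rw [conjMon_cons, Multiset.map_cons, Multiset.sum_cons,
      ← ih fun b hb => h b (Multiset.mem_cons_of_mem hb)]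
    simp only [Finsupp.add_apply, Finset.sum_add_distrib]
    congr 1
    simp only [Finsupp.finsetSum_apply, Finsupp.single_apply, Finset.sum_ite_eq']
    rw [← Finset.sum_filter, Finset.filter_filter]
    simp only [Finset.mem_filter, Finset.mem_univ, true_and]
    have ha := h a (Multiset.mem_cons_self a P)
    have hm : min a k ≤ N := le_trans (min_le_left _ _) ha
    conv_rhs => rw [← card_lt_fin hm]
    rw [Finset.card_eq_sum_ones]
    refine Finset.sum_congr ?_ fun _ _ => rfl
    ext i
    simp [and_comm]

theorem part_le {n : ℕ} (p : Nat.Partition n) : ∀ a ∈ p.parts, a ≤ n := by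
  intro a ha
  have := Multiset.le_sum_of_mem ha
  rwa [p.parts_sum] at this

theorem min_sum_succ (P : Multiset ℕ) (k : ℕ) :
    (P.map fun a => min a (k+1)).sum = (P.map fun a => min a k).sum
      + (P.filter fun a => k + 1 ≤ a).card := by
  induction P using Multiset.induction_on with
  | empty => simp
  | cons a P ih =>
    simp only [Multiset.map_cons, Multiset.sum_cons, ih, Multiset.filter_cons]
    by_cases h : k + 1 ≤ a <;> simp [h] <;> omega

theorem count_eq (P : Multiset ℕ) (k : ℕ) :
    (P.filter fun a => k ≤ a).card = (P.filter fun a => k + 1 ≤ a).card + P.count k := by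
  induction P using Multiset.induction_on with
  | empty => simp
  | cons a P ih =>
    simp only [Multiset.filter_cons, Multiset.count_cons]
    rcases lt_trichotomy a k with h | h | h
    · rw [if_neg (by omega), if_neg (by omega), if_neg (by omega)]; simpa using ih
    · rw [if_pos (by omega), if_neg (by omega), if_pos (by omega)]; simp [ih]; omega
    · rw [if_pos (by omega), if_pos (by omega), if_neg (by omega)]; simp [ih]; omega

theorem conjSum_inj {n : ℕ} (p r : Nat.Partition n) (h : conjSum p = conjSum r) : p = r := by
  have hc : ∀ k, (p.parts.filter fun a => k + 1 ≤ a).card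
      = (r.parts.filter fun a => k + 1 ≤ a).card := by
    intro k
    have h1 := congrFun h k
    have h2 := congrFun h (k+1)
    simp only [conjSum, min_sum_succ] at h1 h2
    omega
  ext k
  cases k with
  | zero =>
    have h0 : ∀ s : Nat.Partition n, s.parts.count 0 = 0 := fun s =>
      Multiset.count_eq_zero.2 fun hm => lt_irrefl _ (s.parts_pos hm)
    rw [h0, h0]
  | succ k =>
    have h1 := count_eq p.parts (k+1)
    have h2 := count_eq r.parts (k+1)
    have h3 := hc k
    have h4 := hc (k+1)
    omega

theorem exists_colouring {n N : ℕ} (hN : n ≤ N) (G : SimpleGraph (Fin n))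
    (R : Type) [CommRing R] [IsDomain R] [CharZero R]
    (F : MvPolynomial (Fin N) R)
    (hF : ∀ m, coeff m F ≠ 0 → ∃ κ : Fin n → Fin N, IsProper G κ ∧
      (∑ i, Finsupp.single (κ i) 1 : Fin N →₀ ℕ) = m)
    (c : Nat.Partition n → R) (h : F = ∑ p : Nat.Partition n, C (c p) * eProd N R p)
    (p : Nat.Partition n) (hp : c p ≠ 0) :
    ∃ κ : Fin n → Fin N, IsProper G κ ∧
      ∀ k, conjSum p k ≤ ((Finset.univ : Finset (Fin n)).filter fun v => (κ v).val < k).card := by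
  have hfin : (conjSum '' {r : Nat.Partition n | c r ≠ 0}).Finite := (Set.toFinite _).image _
  obtain ⟨_, hle, ⟨r, hr, rfl⟩, hmax⟩ := hfin.exists_le_maximal ⟨p, hp, rfl⟩
  have hcs : ∀ (r : Nat.Partition n) k, ∑ i ∈ (Finset.univ : Finset (Fin N)).filter (fun i => i.val < k),
      conjMon N r.parts i = conjSum r k := fun r k =>
    conjMon_sum _ (fun a ha => (part_le r a ha).trans hN) k
  have hco : coeff (conjMon N r.parts) F ≠ 0 := by
    rw [h, coeff_sum, Finset.sum_eq_single r]
    · rw [coeff_C_mul, eProd_coeff]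
      exact mul_ne_zero hr (Nat.cast_ne_zero.2
        (aux_prod_pos _ fun a ha => (part_le r a ha).trans hN))
    · intro s _ hs
      rw [coeff_C_mul, eProd_coeff]
      by_contra hne
      have hcs0 := left_ne_zero_of_mul hne
      have h1 := Nat.cast_ne_zero.1 (right_ne_zero_of_mul hne)
      have h2 : conjSum r ≤ conjSum s := by
        intro k
        rw [← hcs r k]
        refine (aux_prod_le _ _ _ h1).trans ?_
        unfold conjSum
        refine Multiset.sum_map_le_sum_map _ _ fun a _ => ?_
        refine min_le_min le_rfl ?_
        rw [Fin.card_filter_val_lt]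
        exact min_le_right _ _
      have h3 := hmax ⟨s, hcs0, rfl⟩ h2
      exact hs (conjSum_inj _ _ (le_antisymm h3 h2))
    · simp
  obtain ⟨κ, hκ, hm⟩ := hF _ hco
  refine ⟨κ, hκ, fun k => (hle k).trans ?_⟩
  rw [← hcs r k, ← hm]
  simp only [Finsupp.finsetSum_apply, Finsupp.single_apply]
  rw [Finset.sum_comm]
  simp only [Finset.sum_ite_eq, Finset.mem_filter, Finset.mem_univ, true_and]
  rw [← Finset.sum_filter, Finset.card_eq_sum_ones]

theorem exists_partSum {n : ℕ} (p : Nat.Partition n) (k : ℕ) :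
    ∃ J, n + J * k ≤ partSum p k + conjSum p J := by
  let f : ℕ → ℕ := fun j => (p.parts.filter fun a => j ≤ a).card
  have hanti : Antitone f := by
    intro i j hij
    exact Multiset.card_le_card (Multiset.monotone_filter_right _ fun a ha => hij.trans ha)
  have hconj : ∀ J, conjSum p J = ∑ j ∈ Finset.range J, f (j+1) := by
    intro J
    induction J with
    | zero => simp [conjSum]
    | succ J ih => rw [Finset.sum_range_succ, ← ih]; exact min_sum_succ _ _
  have hn : conjSum p n = n := by
    have : p.parts.map (fun a => min a n) = p.parts.map id :=
      Multiset.map_congr rfl fun a ha => min_eq_left (part_le p a ha)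
    rw [conjSum, this, Multiset.map_id, p.parts_sum]
  have hps : partSum p k = ∑ j ∈ Finset.range n, min (f (j+1)) k := by
    rw [partSum, Finset.range_eq_Ico, Finset.sum_Ico_add' (fun j => min (f j) k) 0 n 1]
    rfl
  have key : ∀ m, ∃ J ≤ m, ∑ j ∈ Finset.range m, f (j+1) + J * k ≤
      ∑ j ∈ Finset.range m, min (f (j+1)) k + ∑ j ∈ Finset.range J, f (j+1) := by
    intro m
    induction m with
    | zero => exact ⟨0, le_rfl, by simp⟩
    | succ m ih =>
      by_cases hk : k ≤ f (m+1)
      · refine ⟨m+1, le_rfl, ?_⟩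
        have : ∑ j ∈ Finset.range (m+1), min (f (j+1)) k = (m+1) * k := by
          rw [Finset.sum_congr rfl (g := fun _ => k)]
          · simp
          · intro j hj
            have := Finset.mem_range.1 hj
            exact min_eq_right (hk.trans (hanti (by omega)))
        omega
      · obtain ⟨J, hJ, h⟩ := ih
        refine ⟨J, by omega, ?_⟩
        rw [Finset.sum_range_succ, Finset.sum_range_succ, min_eq_left (by omega)]
        omega
  obtain ⟨J, _, h⟩ := key n
  refine ⟨J, ?_⟩
  rw [← hconj, ← hconj, hn, ← hps] at h
  exact h

theorem graph_part {n N : ℕ} (G : SimpleGraph (Fin n)) (p : Nat.Partition n)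
    (κ : Fin n → Fin N) (hκ : IsProper G κ)
    (h : ∀ k, conjSum p k ≤ ((Finset.univ : Finset (Fin n)).filter fun v => (κ v).val < k).card)
    (k : ℕ) : conjSum p k ≤ alphaK G k ∧ omegaK G k ≤ partSum p k := by
  constructor
  · refine (h k).trans (le_csSup ⟨n, ?_⟩ ?_)
    · rintro m ⟨B, hd, -, rfl⟩
      rw [← Finset.card_biUnion fun i _ j _ hij => hd i j hij]
      simpa using Finset.card_le_univ (Finset.univ.biUnion B)
    · refine ⟨fun i => Finset.univ.filter fun v => (κ v).val = i.val, ?_, ?_, ?_⟩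
      · intro i j hij
        rw [Finset.disjoint_left]
        intro v hv hv'
        simp only [Finset.mem_filter, Finset.mem_univ, true_and] at hv hv'
        exact hij (Fin.ext (hv.symm.trans hv'))
      · intro i u hu v hv ha
        simp only [Finset.mem_filter, Finset.mem_univ, true_and] at hu hv
        exact hκ u v ha (Fin.ext (hu.trans hv.symm))
      · rw [← Finset.card_biUnion]
        · congr 1
          ext v
          simp only [Finset.mem_filter, Finset.mem_univ, true_and, Finset.mem_biUnion]
          exact ⟨fun hv => ⟨⟨_, hv⟩, rfl⟩, fun ⟨i, hi⟩ => hi ▸ i.2⟩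
        · intro i _ j _ hij
          rw [Function.onFun, Finset.disjoint_left]
          intro v hv hv'
          simp only [Finset.mem_filter, Finset.mem_univ, true_and] at hv hv'
          exact hij (Fin.ext (hv.symm.trans hv'))
  · refine csSup_le ⟨0, fun _ => ∅, by simp, by simp [IsCliqueFinset], by simp⟩ ?_
    rintro m ⟨B, hd, hc, rfl⟩
    obtain ⟨J, hJ⟩ := exists_partSum p k
    have hJ' := h J
    set A := (Finset.univ : Finset (Fin n)).filter fun v => (κ v).val < J with hA
    rw [← Finset.card_biUnion fun i _ j _ hij => hd i j hij]
    have h1 := Finset.card_union_add_card_inter (Finset.univ.biUnion B) A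
    have h2 : (Finset.univ.biUnion B ∪ A).card ≤ n := by
      simpa using Finset.card_le_univ (Finset.univ.biUnion B ∪ A)
    have h3 : (Finset.univ.biUnion B ∩ A).card ≤ k * J := by
      rw [Finset.biUnion_inter]
      have : ∀ i ∈ (Finset.univ : Finset (Fin k)), (B i ∩ A).card ≤ J := by
        intro i _
        rw [← Finset.card_range J]
        refine Finset.card_le_card_of_injOn (fun v => (κ v).val) ?_ ?_
        · intro v hv
          have hv := (Finset.mem_inter.1 hv).2
          simpa [hA] using hv
        · intro u hu v hv huv
          by_contra hne
          exact hκ u v (hc i u (Finset.mem_inter.1 hu).1 v (Finset.mem_inter.1 hv).1 hne)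
            (Fin.ext huv)
      simpa using Finset.card_biUnion_le_card_mul _ _ _ this
    rw [mul_comm] at h3
    omega

theorem prod_X_eq {n N : ℕ} (R : Type) [CommRing R] (κ : Fin n → Fin N) :
    (∏ i, X (κ i) : MvPolynomial (Fin N) R) =
      monomial (∑ i, Finsupp.single (κ i) 1 : Fin N →₀ ℕ) 1 := by
  rw [monomial_sum_one]
  rfl

theorem stmt8 (n N : ℕ) (hN : n ≤ N) (G : SimpleGraph (Fin n)) :
    (∀ c : Nat.Partition n → ℤ,
      chromSym n N G = ∑ p : Nat.Partition n, C (c p) * eProd N ℤ p →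
      ∀ p : Nat.Partition n, c p ≠ 0 → ∀ k, 1 ≤ k →
        conjSum p k ≤ alphaK G k ∧ omegaK G k ≤ partSum p k) ∧
    ((chromQSym n N G).IsSymmetric →
      ∀ c : Nat.Partition n → Polynomial ℤ,
      chromQSym n N G = ∑ p : Nat.Partition n, C (c p) * eProd N (Polynomial ℤ) p →
      ∀ p : Nat.Partition n, c p ≠ 0 → ∀ k, 1 ≤ k →
        conjSum p k ≤ alphaK G k ∧ omegaK G k ≤ partSum p k) := by
  constructor
  · intro c h p hp k _
    obtain ⟨κ, hκ, hk⟩ := exists_colouring hN G ℤ _ (fun m hm => by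
      rw [chromSym, coeff_sum] at hm
      obtain ⟨κ, _, hne⟩ := Finset.exists_ne_zero_of_sum_ne_zero hm
      by_cases hP : IsProper G κ
      · refine ⟨κ, hP, ?_⟩
        by_contra hcon
        rw [if_pos hP, prod_X_eq, coeff_monomial, if_neg hcon] at hne
        exact hne rfl
      · rw [if_neg hP] at hne
        exact absurd (coeff_zero _) hne) c h p hp
    exact graph_part G p κ hκ hk k
  · intro _ c h p hp k _
    obtain ⟨κ, hκ, hk⟩ := exists_colouring hN G (Polynomial ℤ) _ (fun m hm => by
      rw [chromQSym, coeff_sum] at hm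
      obtain ⟨κ, _, hne⟩ := Finset.exists_ne_zero_of_sum_ne_zero hm
      by_cases hP : IsProper G κ
      · refine ⟨κ, hP, ?_⟩
        by_contra hcon
        rw [if_pos hP, prod_X_eq, coeff_C_mul, coeff_monomial, if_neg hcon, mul_zero] at hne
        exact hne rfl
      · rw [if_neg hP] at hne
        exact absurd (coeff_zero _) hne) c h p hp
    exact graph_part G p κ hκ hk k
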